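/- In the uplink pilot model, the estimator ĥ_mk = √(pτ) R_mk Q_m y_mk is the linear minimum-mean-square-error estimator of h_mk from y_mk: for every deterministic matrix C ∈ ℂ^{L×L}, E[‖C y_mk − h_mk‖²] ≥ E[‖ĥ_mk − h_mk‖²]. -/

import Mathlib

open MeasureTheory ProbabilityTheory Matrix
open scoped ComplexOrder

/-- The standard complex Gaussian measure `CN(0,1)` on `ℂ`:
the law of `(a + i b)/√2` with `a, b` independent standard real Gaussians. -/
noncomputable def stdCGauss : Measure ℂ :=
  Measure.map (fun p : ℝ × ℝ => ((p.1 : ℂ) + (p.2 : ℂ) * Complex.I) / (Real.sqrt 2 : ℂ))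
    ((gaussianReal 0 1).prod (gaussianReal 0 1))

/-- The law of a standard complex Gaussian random vector with i.i.d. `CN(0,1)` coordinates. -/
noncomputable def stdCGaussPi (ι : Type) [Fintype ι] : Measure (ι → ℂ) :=
  Measure.pi fun _ => stdCGauss

/-- The law of a standard complex Gaussian random matrix with i.i.d. `CN(0,1)` entries. -/
noncomputable def stdCGaussMat (ι κ : Type) [Fintype ι] [Fintype κ] : Measure (ι → κ → ℂ) :=
  Measure.pi fun _ => stdCGaussPi κ

/-- Entrywise expectation of a random complex matrix. -/
noncomputable def matExp {Ω n m : Type} [MeasurableSpace Ω] (μ : Measure Ω)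
    (X : Ω → Matrix n m ℂ) : Matrix n m ℂ :=
  Matrix.of fun i j => ∫ ω, X ω i j ∂μ

/-- The AP–RIS channel matrix `W = √β̃ · R_RIS^{1/2} D R_AP^{1/2}` (with `S = R^{1/2}`). -/
noncomputable def Wmat {N L : ℕ} (βm : ℝ) (SRISm : Matrix (Fin N) (Fin N) ℂ)
    (SAP : Matrix (Fin L) (Fin L) ℂ) (Dω : Fin N → Fin L → ℂ) :
    Matrix (Fin N) (Fin L) ℂ :=
  (Real.sqrt βm : ℂ) • (SRISm * Matrix.of Dω * SAP)

/-- The RIS–UE channel vector `q = √β̃ · R_RIS^{1/2} c` (with `S = R^{1/2}`). -/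
noncomputable def qVec {N : ℕ} (βu : ℝ) (SRISu : Matrix (Fin N) (Fin N) ℂ)
    (cω : Fin N → ℂ) : Fin N → ℂ :=
  (Real.sqrt βu : ℂ) • (SRISu *ᵥ cω)

/-- The cascaded channel `h = Wᴴ Φ q`. -/
noncomputable def hChan {N L : ℕ} (βm : ℝ) (SRISm : Matrix (Fin N) (Fin N) ℂ)
    (SAP : Matrix (Fin L) (Fin L) ℂ) (Φ : Matrix (Fin N) (Fin N) ℂ)
    (βu : ℝ) (SRISu : Matrix (Fin N) (Fin N) ℂ)
    (Dω : Fin N → Fin L → ℂ) (cω : Fin N → ℂ) : Fin L → ℂ :=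
  (Wmat βm SRISm SAP Dω)ᴴ *ᵥ (Φ *ᵥ qVec βu SRISu cω)

/-- `R̃ = β̃_m β̃_u · R_RIS,m Φ R_RIS,u Φᴴ`. -/
noncomputable def Rtil {N : ℕ} (βm βu : ℝ) (RRISm Φ RRISu : Matrix (Fin N) (Fin N) ℂ) :
    Matrix (Fin N) (Fin N) ℂ :=
  ((βm * βu : ℝ) : ℂ) • (RRISm * Φ * RRISu * Φᴴ)

/-- A family of centred, square-integrable and orthonormal complex random variables. -/
structure IsWhiteFamily {α ι : Type*} [MeasurableSpace α] (ν : Measure α) (f : ι → α → ℂ) :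
    Prop where
  meas : ∀ i, Measurable (f i)
  memLp : ∀ i, MemLp (f i) 2 ν
  mean : ∀ i, ∫ x, f i x ∂ν = 0
  var : ∀ i, ∫ x, f i x * star (f i x) ∂ν = 1
  cov : ∀ i j, i ≠ j → ∫ x, f i x * star (f j x) ∂ν = 0

namespace IsWhiteFamily

variable {α β ι κ : Type*} [MeasurableSpace α] [MeasurableSpace β]
  {ν : Measure α} {ρ : Measure β} {f : ι → α → ℂ} {g : κ → β → ℂ}

lemma integrable_mul_star (hf : IsWhiteFamily ν f) (i j : ι) :
    Integrable (fun x => f i x * star (f j x)) ν :=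
  (hf.memLp i).integrable_mul (hf.memLp j).star

lemma integral_mul_star [DecidableEq ι] (hf : IsWhiteFamily ν f) (i j : ι) :
    ∫ x, f i x * star (f j x) ∂ν = if i = j then 1 else 0 := by
  split_ifs with h
  · subst h; exact hf.var i
  · exact hf.cov i j h

lemma star (hf : IsWhiteFamily ν f) : IsWhiteFamily ν (fun i x => star (f i x)) where
  meas i := continuous_star.measurable.comp (hf.meas i)
  memLp i := (hf.memLp i).star
  mean i := by
    have := integral_conj (μ := ν) (f := f i)
    rw [hf.mean, map_zero] at this
    exact this
  var i := by simpa [mul_comm] using hf.var i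
  cov i j h := by simpa [mul_comm] using hf.cov j i h.symm

lemma comp {φ : β → α} (hf : IsWhiteFamily ν f) (hφ : MeasurePreserving φ ρ ν) :
    IsWhiteFamily ρ (fun i x => f i (φ x)) := by
  have key : ∀ g : α → ℂ, Measurable g → ∫ x, g (φ x) ∂ρ = ∫ x, g x ∂ν := fun g hg => by
    rw [← hφ.map_eq, integral_map hφ.measurable.aemeasurable hg.aestronglyMeasurable]
  have hm := fun i j => (hf.meas i).mul (hf.star.meas j)
  exact
    { meas := fun i => (hf.meas i).comp hφ.measurable
      memLp := fun i => (hf.memLp i).comp_measurePreserving hφ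
      mean := fun i => (key _ (hf.meas i)).trans (hf.mean i)
      var := fun i => (key _ (hm i i)).trans (hf.var i)
      cov := fun i j h => (key _ (hm i j)).trans (hf.cov i j h) }

lemma reindex {σ : Type*} (hf : IsWhiteFamily ν f) (e : σ → ι) (he : Function.Injective e) :
    IsWhiteFamily ν (fun s => f (e s)) where
  meas _ := hf.meas _
  memLp _ := hf.memLp _
  mean _ := hf.mean _
  var _ := hf.var _
  cov _ _ h := hf.cov _ _ (he.ne h)

/-- Products of elements of white families on two independent spaces form a white family. -/
lemma tensor [SFinite ν] [SFinite ρ] (hf : IsWhiteFamily ν f) (hg : IsWhiteFamily ρ g) :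
    IsWhiteFamily (ν.prod ρ) (fun (s : ι × κ) x => f s.1 x.1 * g s.2 x.2) := by
  have hm : ∀ s : ι × κ, Measurable fun x : α × β => f s.1 x.1 * g s.2 x.2 := fun s =>
    ((hf.meas _).comp measurable_fst).mul ((hg.meas _).comp measurable_snd)
  have key : ∀ s t : ι × κ, ∫ x : α × β, (f s.1 x.1 * g s.2 x.2) *
      Star.star (f t.1 x.1 * g t.2 x.2) ∂(ν.prod ρ)
      = (∫ x, f s.1 x * Star.star (f t.1 x) ∂ν) * ∫ x, g s.2 x * Star.star (g t.2 x) ∂ρ := by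
    intro s t
    rw [← integral_prod_mul]
    congr 1
    ext x
    simp only [star_mul']
    ring
  refine ⟨hm, fun s => ?_, fun s => ?_, fun s => ?_, fun s t h => ?_⟩
  · rw [memLp_two_iff_integrable_sq_norm (hm s).aestronglyMeasurable]
    have := ((memLp_two_iff_integrable_sq_norm (hf.meas s.1).aestronglyMeasurable).1
      (hf.memLp s.1)).mul_prod
      ((memLp_two_iff_integrable_sq_norm (hg.meas s.2).aestronglyMeasurable).1 (hg.memLp s.2))
    simpa only [norm_mul, mul_pow] using this
  · rw [integral_prod_mul, hf.mean, zero_mul]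
  · rw [key, hf.var, hg.var, one_mul]
  · rw [key]
    by_cases h1 : s.1 = t.1
    · rw [hg.cov _ _ fun h2 => h (Prod.ext h1 h2), mul_zero]
    · rw [hf.cov _ _ h1, zero_mul]

/-- White families on two independent spaces combine to a single white family. -/
lemma sum [IsProbabilityMeasure ν] [IsProbabilityMeasure ρ]
    (hf : IsWhiteFamily ν f) (hg : IsWhiteFamily ρ g) :
    IsWhiteFamily (ν.prod ρ)
      (Sum.elim (fun i x => f i x.1) (fun j x => g j x.2)) := by
  have hf' := hf.comp (measurePreserving_fst (μ := ν) (ν := ρ))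
  have hg' := hg.comp (measurePreserving_snd (μ := ν) (ν := ρ))
  refine ⟨?_, ?_, ?_, ?_, ?_⟩
  · rintro (i | j); exacts [hf'.meas i, hg'.meas j]
  · rintro (i | j); exacts [hf'.memLp i, hg'.memLp j]
  · rintro (i | j); exacts [hf'.mean i, hg'.mean j]
  · rintro (i | j); exacts [hf'.var i, hg'.var j]
  · rintro (i | i) (j | j) h
    · exact hf'.cov i j fun e => h (e ▸ rfl)
    · refine (integral_prod_mul (f i) (fun y => Star.star (g j y))).trans ?_
      rw [hf.mean, zero_mul]
    · have := integral_prod_mul (μ := ν) (ν := ρ) (fun x => Star.star (f j x)) (g i)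
      rw [hg.mean, mul_zero] at this
      simpa only [Sum.elim_inl, Sum.elim_inr, mul_comm] using this
    · exact hg'.cov i j fun e => h (e ▸ rfl)

lemma pi {κ : Type*} [Fintype κ] [IsProbabilityMeasure ν] (hf : IsWhiteFamily ν f) :
    IsWhiteFamily (Measure.pi fun _ : κ => ν) (fun (s : κ × ι) x => f s.2 (x s.1)) := by
  have h := fun k => hf.comp (measurePreserving_eval (fun _ : κ => ν) k)
  refine ⟨fun s => (h s.1).meas s.2, fun s => (h s.1).memLp s.2, fun s => (h s.1).mean s.2,
    fun s => (h s.1).var s.2, ?_⟩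
  rintro ⟨k, i⟩ ⟨l, j⟩ hne
  by_cases hkl : k = l
  · subst hkl
    exact (h k).cov i j fun e => hne (e ▸ rfl)
  · have hind : IndepFun (fun x : κ → α => x k) (fun x => x l) (Measure.pi fun _ : κ => ν) :=
      (iIndepFun_pi (μ := fun _ : κ => ν) (X := fun _ x => x)
        (fun _ => aemeasurable_id)).indepFun hkl
    have hind' := hind.comp (hf.meas i) (hf.star.meas j)
    refine (hind'.integral_mul_eq_mul_integral
      ((h k).meas i).aestronglyMeasurable ((h l).star.meas j).aestronglyMeasurable).trans ?_
    have := (h k).mean i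
    simp only [Function.eval] at this
    simp only [Function.comp_def]
    rw [this, zero_mul]

/-- The mean square norm of a linear image of a white family. -/
lemma integral_sum_norm_sq {m : Type*} [Fintype m] [Fintype ι] (hf : IsWhiteFamily ν f)
    (M : Matrix m ι ℂ) :
    ((∫ x, ∑ i, ‖(M *ᵥ fun s => f s x) i‖ ^ 2 ∂ν : ℝ) : ℂ) = (M * Mᴴ).trace := by
  classical
  have hint : ∀ i s t, Integrable
      (fun x => M i s * Star.star (M i t) * (f s x * Star.star (f t x))) ν :=
    fun i s t => (hf.integrable_mul_star s t).const_mul _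
  have hexp : ∀ x, ((∑ i, ‖(M *ᵥ fun s => f s x) i‖ ^ 2 : ℝ) : ℂ) =
      ∑ i, ∑ s, ∑ t, M i s * Star.star (M i t) * (f s x * Star.star (f t x)) := by
    intro x
    push_cast
    refine Finset.sum_congr rfl fun i _ => ?_
    rw [← Complex.mul_conj']
    simp only [mulVec, dotProduct, map_sum, Finset.sum_mul_sum, map_mul]
    refine Finset.sum_congr rfl fun s _ => Finset.sum_congr rfl fun t _ => ?_
    simp only [← starRingEnd_apply]
    ring
  refine (integral_ofReal (𝕜 := ℂ)).symm.trans ?_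
  refine (integral_congr_ae (.of_forall hexp)).trans ?_
  rw [integral_finsetSum _ fun i _ => integrable_finsetSum _ fun s _ =>
    integrable_finsetSum _ fun t _ => hint i s t]
  refine Finset.sum_congr rfl fun i _ => ?_
  rw [integral_finsetSum _ fun s _ => integrable_finsetSum _ fun t _ => hint i s t]
  simp only [diag_apply, mul_apply, conjTranspose_apply]
  refine Finset.sum_congr rfl fun s _ => ?_
  rw [integral_finsetSum _ fun t _ => hint i s t]
  simp_rw [integral_const_mul, hf.integral_mul_star]
  simp

end IsWhiteFamily

lemma integral_sq_stdGaussian : ∫ x, x ^ 2 ∂(gaussianReal 0 1) = 1 := by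
  have h := variance_eq_sub (memLp_id_gaussianReal (μ := 0) (v := 1) 2)
  rw [variance_id_gaussianReal] at h
  simpa using h.symm

lemma isWhiteFamily_stdGaussian :
    IsWhiteFamily (gaussianReal 0 1) (fun (_ : Unit) x => (x : ℂ)) where
  meas _ := Complex.measurable_ofReal
  memLp _ := (memLp_id_gaussianReal (μ := 0) (v := 1) 2).ofReal
  mean _ := integral_ofReal.trans (by simp)
  var _ := by
    have : ∀ x : ℝ, (x : ℂ) * star (x : ℂ) = ((x ^ 2 : ℝ) : ℂ) := fun x => by
      rw [← starRingEnd_apply, Complex.conj_ofReal]; push_cast; ring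
    simp_rw [this]
    refine (integral_ofReal (𝕜 := ℂ) (f := fun x : ℝ => x ^ 2)).trans ?_
    simp only [integral_sq_stdGaussian, RCLike.ofReal_one]
  cov _ _ h := (h rfl).elim

lemma measurable_stdCGauss_map :
    Measurable (fun p : ℝ × ℝ =>
      ((p.1 : ℂ) + (p.2 : ℂ) * Complex.I) / (Real.sqrt 2 : ℂ)) := by
  fun_prop

instance : IsProbabilityMeasure stdCGauss :=
  Measure.isProbabilityMeasure_map measurable_stdCGauss_map.aemeasurable

instance (ι : Type) [Fintype ι] : IsProbabilityMeasure (stdCGaussPi ι) :=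
  inferInstanceAs (IsProbabilityMeasure (Measure.pi _))

instance (ι κ : Type) [Fintype ι] [Fintype κ] : IsProbabilityMeasure (stdCGaussMat ι κ) :=
  inferInstanceAs (IsProbabilityMeasure (Measure.pi _))

lemma isWhiteFamily_stdCGauss : IsWhiteFamily stdCGauss (fun (_ : Unit) z => z) := by
  have hab := isWhiteFamily_stdGaussian.sum isWhiteFamily_stdGaussian
  set P := (gaussianReal 0 1).prod (gaussianReal 0 1)
  have h2 : ((Real.sqrt 2 : ℝ) : ℂ) * (Real.sqrt 2 : ℝ) = 2 := by
    rw [← Complex.ofReal_mul, Real.mul_self_sqrt (by norm_num)]; norm_num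
  have hL : ∀ s, MemLp _ 2 P := hab.memLp
  have ha : MemLp (fun p : ℝ × ℝ => (p.1 : ℂ)) 2 P := hL (Sum.inl ())
  have hb : MemLp (fun p : ℝ × ℝ => (p.2 : ℂ)) 2 P := hL (Sum.inr ())
  have hmem : MemLp (fun p : ℝ × ℝ =>
      ((p.1 : ℂ) + (p.2 : ℂ) * Complex.I) / (Real.sqrt 2 : ℂ)) 2 P := by
    have := (ha.add (hb.const_mul Complex.I)).const_mul ((Real.sqrt 2 : ℂ)⁻¹)
    refine this.congr_norm (by fun_prop) (.of_forall fun p => ?_)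
    simp [div_eq_inv_mul, mul_comm]
  have hmap := measurable_stdCGauss_map.aemeasurable (μ := P)
  refine ⟨fun _ => measurable_id, fun _ => ?_, fun _ => ?_, fun _ => ?_, fun _ _ h => (h rfl).elim⟩
  · exact (memLp_map_measure_iff measurable_id.aestronglyMeasurable hmap).2 hmem
  · rw [stdCGauss, integral_map hmap (f := fun z => z) measurable_id.aestronglyMeasurable, integral_div,
      integral_add (ha.integrable (by norm_num)) ((hb.integrable (by norm_num)).mul_const _),
      integral_mul_const]
    have h1 := hab.mean (Sum.inl ())
    have h2 := hab.mean (Sum.inr ())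
    simp only [Sum.elim_inl, Sum.elim_inr] at h1 h2
    rw [h1, h2]
    simp
  · rw [stdCGauss, integral_map (f := fun z => z * star z) hmap
      (measurable_id.mul continuous_star.measurable).aestronglyMeasurable]
    have h11 := hab.var (Sum.inl ())
    have h22 := hab.var (Sum.inr ())
    have i1 := hab.integrable_mul_star (Sum.inl ()) (Sum.inl ())
    have i2 := hab.integrable_mul_star (Sum.inr ()) (Sum.inr ())
    simp only [Sum.elim_inl, Sum.elim_inr] at h11 h22 i1 i2
    have hexp : ∀ p : ℝ × ℝ, ((p.1 : ℂ) + (p.2 : ℂ) * Complex.I) / (Real.sqrt 2 : ℂ) *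
        star (((p.1 : ℂ) + (p.2 : ℂ) * Complex.I) / (Real.sqrt 2 : ℂ)) =
        ((p.1 : ℂ) * star (p.1 : ℂ) + (p.2 : ℂ) * star (p.2 : ℂ)) / 2 := by
      intro p
      simp only [← starRingEnd_apply, map_div₀, map_add, map_mul, Complex.conj_ofReal,
        Complex.conj_I]
      rw [div_mul_div_comm, h2]
      congr 1
      linear_combination (-(p.2 : ℂ) ^ 2) * Complex.I_sq
    simp_rw [hexp]
    rw [integral_div, integral_add i1 i2, h11, h22]
    norm_num

lemma isWhiteFamily_stdCGaussPi (ι : Type) [Fintype ι] :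
    IsWhiteFamily (stdCGaussPi ι) (fun i x => x i) :=
  isWhiteFamily_stdCGauss.pi.reindex (fun i => (i, ())) (Prod.mk_left_injective ())

lemma isWhiteFamily_stdCGaussMat (ι κ : Type) [Fintype ι] [Fintype κ] :
    IsWhiteFamily (stdCGaussMat ι κ) (fun (s : ι × κ) x => x s.1 s.2) :=
  (isWhiteFamily_stdCGaussPi κ).pi

/-- Orthogonality principle: if the error of `C₀` is orthogonal to the observation `Y`,
then `C₀` minimises the mean square error. -/
lemma trace_error_le {m ι : Type*} [Fintype m] [Fintype ι]
    (Y H : Matrix m ι ℂ) (C₀ C : Matrix m m ℂ) (h0 : (C₀ * Y - H) * Yᴴ = 0) :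
    ((C₀ * Y - H) * (C₀ * Y - H)ᴴ).trace ≤ ((C * Y - H) * (C * Y - H)ᴴ).trace := by
  set M := C₀ * Y - H with hM
  have hC : C * Y - H = (C - C₀) * Y + M := by rw [hM, Matrix.sub_mul]; abel
  have h0' : Y * Mᴴ = 0 := by simpa using congrArg conjTranspose h0
  have hA : (C * Y - H) * (C * Y - H)ᴴ =
      ((C - C₀) * Y) * ((C - C₀) * Y)ᴴ + M * Mᴴ := by
    rw [hC, conjTranspose_add, Matrix.mul_add, Matrix.add_mul, Matrix.add_mul,
      Matrix.mul_assoc (C - C₀) Y Mᴴ, h0', conjTranspose_mul (C - C₀) Y, ← Matrix.mul_assoc M, h0]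
    simp
  rw [hA, trace_add]
  exact le_add_of_nonneg_left (posSemidef_self_mul_conjTranspose _).trace_nonneg

/-- The coefficients of the cascaded channel of user `l` with respect to the products
`star (D b a) * c l n`. -/
noncomputable def cascadeCoeff {N L : ℕ} {K : Type} [DecidableEq K] (r : ℂ)
    (S : Matrix (Fin L) (Fin L) ℂ) (T : Matrix (Fin N) (Fin N) ℂ) (l : K) :
    Matrix (Fin L) ((Fin N × Fin L) × (K × Fin N)) ℂ :=
  Matrix.of fun i s => if s.2.1 = l then r * (S i s.1.2 * T s.1.1 s.2.2) else 0

section cascadeCoeff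

variable {N L : ℕ} {K : Type} [DecidableEq K] [Fintype K]

lemma cascadeCoeff_mul_conjTranspose_of_ne (r r' : ℂ) (S S' : Matrix (Fin L) (Fin L) ℂ)
    (T T' : Matrix (Fin N) (Fin N) ℂ) {l l' : K} (h : l ≠ l') :
    cascadeCoeff r S T l * (cascadeCoeff r' S' T' l')ᴴ = 0 := by
  ext i j
  simp only [mul_apply, conjTranspose_apply, cascadeCoeff, of_apply, Matrix.zero_apply]
  refine Finset.sum_eq_zero fun s _ => ?_
  by_cases hs : s.2.1 = l
  · rw [if_neg (hs ▸ h : ¬ s.2.1 = l'), star_zero, mul_zero]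
  · rw [if_neg hs, zero_mul]

lemma cascadeCoeff_mul_conjTranspose_self (r : ℂ) (S : Matrix (Fin L) (Fin L) ℂ)
    (T : Matrix (Fin N) (Fin N) ℂ) (l : K) :
    cascadeCoeff r S T l * (cascadeCoeff r S T l)ᴴ =
      (r * star r * (T * Tᴴ).trace) • (S * Sᴴ) := by
  ext i j
  simp only [mul_apply, conjTranspose_apply, cascadeCoeff, of_apply, Matrix.smul_apply, smul_eq_mul,
    trace, diag_apply, Fintype.sum_prod_type]
  simp only [apply_ite star, star_zero, mul_ite, ite_mul, zero_mul, mul_zero, ← ite_and, and_self,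
    star_mul']
  have : ∀ (b : Fin N) (a : Fin L), (∑ l' : K, ∑ n : Fin N, if l' = l then
      r * (S i a * T b n) * (star r * (star (S j a) * star (T b n))) else 0) =
      (r * star r * (S i a * star (S j a))) * ∑ n, T b n * star (T b n) := by
    intro b a
    rw [Finset.sum_comm]
    simp only [Finset.sum_ite_eq', Finset.mem_univ, if_true, Finset.mul_sum]
    exact Finset.sum_congr rfl fun n _ => by ring
  simp only [this, ← Finset.sum_mul, ← Finset.mul_sum]
  ring

lemma cascadeCoeff_mulVec (r : ℂ) (S : Matrix (Fin L) (Fin L) ℂ)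
    (T : Matrix (Fin N) (Fin N) ℂ) (l : K) (d : Fin N → Fin L → ℂ) (c : K → Fin N → ℂ) :
    (cascadeCoeff r S T l *ᵥ fun s => star (d s.1.1 s.1.2) * c s.2.1 s.2.2) =
      r • (S *ᵥ ((Matrix.of d)ᴴ *ᵥ (T *ᵥ c l))) := by
  ext i
  simp only [mulVec, dotProduct, cascadeCoeff, of_apply, conjTranspose_apply, Pi.smul_apply,
    smul_eq_mul, Fintype.sum_prod_type, ite_mul, zero_mul]
  rw [Finset.sum_comm, Finset.mul_sum]
  refine Finset.sum_congr rfl fun a _ => ?_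
  rw [Finset.mul_sum, Finset.mul_sum]
  refine Finset.sum_congr rfl fun b _ => ?_
  rw [Finset.sum_comm]
  simp only [Finset.sum_ite_eq', Finset.mem_univ, if_true, Finset.mul_sum]
  exact Finset.sum_congr rfl fun n _ => by ring

end cascadeCoeff

lemma hChan_eq {N L : ℕ} (βm : ℝ) (SRISm : Matrix (Fin N) (Fin N) ℂ)
    (SAP : Matrix (Fin L) (Fin L) ℂ) (Φ : Matrix (Fin N) (Fin N) ℂ)
    (βu : ℝ) (SRISu : Matrix (Fin N) (Fin N) ℂ) (d : Fin N → Fin L → ℂ) (c : Fin N → ℂ)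
    (hSm : SRISm.IsHermitian) (hSAP : SAP.IsHermitian) :
    hChan βm SRISm SAP Φ βu SRISu d c = ((Real.sqrt βm : ℂ) * (Real.sqrt βu : ℂ)) •
      (SAP *ᵥ ((Matrix.of d)ᴴ *ᵥ ((SRISm * Φ * SRISu) *ᵥ c))) := by
  simp only [hChan, Wmat, qVec, conjTranspose_smul, conjTranspose_mul, hSm.eq, hSAP.eq,
    mulVec_smul, smul_mulVec, mulVec_mulVec, Matrix.smul_mul, Matrix.mul_assoc, smul_smul]
  congr 1
  rw [← starRingEnd_apply, Complex.conj_ofReal, mul_comm]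

/-- `ĥ_mk = √(pτ) R_mk Q_m y_mk` is the linear MMSE estimator of
`h_mk` from `y_mk`: every linear estimate `C y_mk` has at least as large a mean
square error. -/
theorem lmmse_estimator_optimality
    {Ω : Type} [MeasurableSpace Ω] (μ : Measure Ω) [IsProbabilityMeasure μ]
    (N L : ℕ) (K : Type) [Fintype K]
    -- AP-side statistics: path loss and PSD correlation matrices with their PSD square roots
    (βm : ℝ) (hβm : 0 < βm)
    (SRISm RRISm : Matrix (Fin N) (Fin N) ℂ)
    (hSRISm : SRISm.PosSemidef) (hRRISm : SRISm * SRISm = RRISm)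
    (SAP RAP : Matrix (Fin L) (Fin L) ℂ)
    (hSAP : SAP.PosSemidef) (hRAP : SAP * SAP = RAP)
    -- UE-side statistics
    (βu : K → ℝ) (hβu : ∀ l, 0 < βu l)
    (SRISu RRISu : K → Matrix (Fin N) (Fin N) ℂ)
    (hSRISu : ∀ l, (SRISu l).PosSemidef) (hRRISu : ∀ l, SRISu l * SRISu l = RRISu l)
    (Φ : K → Matrix (Fin N) (Fin N) ℂ)
    -- random sources: mutually independent standard complex Gaussians
    (D : Ω → Fin N → Fin L → ℂ) (c : K → Ω → Fin N → ℂ) (z : Ω → Fin L → ℂ)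
    (hD : Measurable D) (hc : ∀ l, Measurable (c l)) (hz : Measurable z)
    (hlaw : μ.map (fun ω => (D ω, fun l => c l ω, z ω))
      = (stdCGaussMat (Fin N) (Fin L)).prod
          ((stdCGaussMat K (Fin N)).prod (stdCGaussPi (Fin L))))
    -- pilot parameters
    (p τ : ℝ) (hp : 0 < p) (hτ : 0 < τ)
    (Pk : Finset K) (k : K) (hk : k ∈ Pk)
    -- the cascaded channels, their covariance matrices, and the pilot observation
    (h : K → Ω → Fin L → ℂ)
    (hh : ∀ l ω, h l ω = hChan βm SRISm SAP (Φ l) (βu l) (SRISu l) (D ω) (c l ω))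
    (Rm : K → Matrix (Fin L) (Fin L) ℂ)
    (hRm : ∀ l, Rm l = (Rtil βm (βu l) RRISm (Φ l) (RRISu l)).trace • RAP)
    (y : Ω → Fin L → ℂ)
    (hy : ∀ ω, y ω = (Real.sqrt (p * τ) : ℂ) • (∑ l ∈ Pk, h l ω) + z ω)
    -- the LMMSE estimation matrices
    (Q : Matrix (Fin L) (Fin L) ℂ)
    (hQ : Q = (((p * τ : ℝ) : ℂ) • (∑ l ∈ Pk, Rm l) + 1)⁻¹)
    (hhat : Ω → Fin L → ℂ)
    (hhat_def : ∀ ω, hhat ω = (Real.sqrt (p * τ) : ℂ) • ((Rm k * Q) *ᵥ y ω))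
    (Ψ : Matrix (Fin L) (Fin L) ℂ)
    (hΨ : Ψ = ((p * τ : ℝ) : ℂ) • (Rm k * Q * Rm k))
    :
    ∀ C : Matrix (Fin L) (Fin L) ℂ,
      (∫ ω, ∑ i, ‖(C *ᵥ y ω - h k ω) i‖ ^ 2 ∂μ)
        ≥ ∫ ω, ∑ i, ‖(hhat ω - h k ω) i‖ ^ 2 ∂μ := by
  intro C
  classical
  set T := fun l => SRISm * Φ l * SRISu l with hT
  set r := fun l => (Real.sqrt βm : ℂ) * (Real.sqrt (βu l) : ℂ) with hr
  set G := fun l => cascadeCoeff (r l) SAP (T l) l with hG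
  have hGG : ∀ l, G l * (G l)ᴴ = Rm l := by
    intro l
    have hrr : r l * star (r l) = ((βm * βu l : ℝ) : ℂ) := by
      simp only [hr, ← starRingEnd_apply, Complex.conj_ofReal, ← Complex.ofReal_mul]
      congr 1
      calc _ = (Real.sqrt βm * Real.sqrt βm) * (Real.sqrt (βu l) * Real.sqrt (βu l)) := by ring
        _ = _ := by rw [Real.mul_self_sqrt hβm.le, Real.mul_self_sqrt (hβu l).le]
    have htr : (T l * (T l)ᴴ).trace = (RRISm * Φ l * RRISu l * (Φ l)ᴴ).trace := by
      simp only [hT, conjTranspose_mul, hSRISm.1.eq, (hSRISu l).1.eq]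
      rw [← hRRISm, ← hRRISu l]
      simp only [← Matrix.mul_assoc]
      rw [trace_mul_comm]
      simp only [← Matrix.mul_assoc]
    rw [hG]
    simp only
    rw [cascadeCoeff_mul_conjTranspose_self, hrr, htr, hRm, Rtil, trace_smul, smul_eq_mul,
      hSAP.1.eq, hRAP]
  set H := fun l => fromCols (G l) (0 : Matrix (Fin L) (Fin L) ℂ) with hH
  set Z := fromCols (0 : Matrix (Fin L) ((Fin N × Fin L) × (K × Fin N)) ℂ)
    (1 : Matrix (Fin L) (Fin L) ℂ) with hZ
  have hHH : ∀ l l', H l * (H l')ᴴ = if l = l' then Rm l else 0 := by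
    intro l l'
    simp only [hH, conjTranspose_fromCols_eq_fromRows_conjTranspose, fromCols_mul_fromRows]
    split_ifs with hll
    · subst hll; simp [hGG]
    · simp [hG, cascadeCoeff_mul_conjTranspose_of_ne _ _ _ _ _ _ hll]
  have hHZ : ∀ l, H l * Zᴴ = 0 := fun l => by
    simp [hH, hZ, conjTranspose_fromCols_eq_fromRows_conjTranspose, fromCols_mul_fromRows]
  have hZH : ∀ l, Z * (H l)ᴴ = 0 := fun l => by
    simpa using congrArg conjTranspose (hHZ l)
  have hZZ : Z * Zᴴ = 1 := by
    simp [hZ, conjTranspose_fromCols_eq_fromRows_conjTranspose, fromCols_mul_fromRows]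
  set s : ℂ := (Real.sqrt (p * τ) : ℂ) with hs
  have hss : s * s = ((p * τ : ℝ) : ℂ) := by
    rw [hs, ← Complex.ofReal_mul, Real.mul_self_sqrt (by positivity)]
  have hstar : star s = s := by rw [hs, ← starRingEnd_apply, Complex.conj_ofReal]
  set Y := s • (∑ l ∈ Pk, H l) + Z with hY
  set A := ((p * τ : ℝ) : ℂ) • (∑ l ∈ Pk, Rm l) + 1 with hA
  have hsum : (∑ l ∈ Pk, H l) * (∑ l ∈ Pk, (H l)ᴴ) = ∑ l ∈ Pk, Rm l := by
    simp only [Matrix.sum_mul, Matrix.mul_sum, hHH]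
    exact Finset.sum_congr rfl fun l hl => by simp [hl]
  have hYY : Y * Yᴴ = A := by
    rw [hY, conjTranspose_add, conjTranspose_smul, conjTranspose_sum, hstar]
    simp only [Matrix.mul_add, Matrix.add_mul, Matrix.smul_mul, Matrix.mul_smul, hsum, hZZ,
      Matrix.sum_mul _ _ Zᴴ, Matrix.mul_sum _ _ Z, hHZ, hZH, Finset.sum_const_zero, smul_zero,
      add_zero, zero_add]
    rw [smul_smul, hss]
  have hHY : H k * Yᴴ = s • Rm k := by
    rw [hY, conjTranspose_add, conjTranspose_smul, conjTranspose_sum, hstar]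
    simp only [Matrix.mul_add, Matrix.mul_smul, Matrix.mul_sum, hHH, hHZ, add_zero]
    simp [hk]
  have hApos : A.PosDef := by
    rw [hA]
    refine PosDef.posSemidef_add ?_ PosDef.one
    refine (posSemidef_sum Pk fun l _ => ?_).smul ?_
    · rw [← hGG l]; exact posSemidef_self_mul_conjTranspose _
    · exact_mod_cast (mul_pos hp hτ).le
  have hQA : Q * A = 1 := by
    rw [hQ]; exact nonsing_inv_mul _ ((isUnit_iff_isUnit_det _).1 hApos.isUnit)
  have horth : ((s • (Rm k * Q)) * Y - H k) * Yᴴ = 0 := by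
    rw [Matrix.sub_mul, Matrix.mul_assoc, hYY, hHY, Matrix.smul_mul, Matrix.mul_assoc, hQA,
      Matrix.mul_one, sub_self]
  have hwhite : IsWhiteFamily μ (Sum.elim
      (fun (t : (Fin N × Fin L) × (K × Fin N)) ω => star (D ω t.1.1 t.1.2) * c t.2.1 ω t.2.2)
      (fun j ω => z ω j)) := by
    have h1 := ((isWhiteFamily_stdCGaussMat (Fin N) (Fin L)).star.tensor
      (isWhiteFamily_stdCGaussMat K (Fin N))).sum (isWhiteFamily_stdCGaussPi (Fin L))
    have hmp : MeasurePreserving (fun ω => (D ω, fun l => c l ω, z ω)) μ _ :=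
      ⟨hD.prodMk ((measurable_pi_lambda _ hc).prodMk hz), hlaw⟩
    have h2 := h1.comp (((measurePreserving_prodAssoc (stdCGaussMat (Fin N) (Fin L))
      (stdCGaussMat K (Fin N)) (stdCGaussPi (Fin L))).symm).comp hmp)
    convert h2 using 1
    funext t ω
    rcases t with t | j <;> rfl
  set ξ := Sum.elim
      (fun (t : (Fin N × Fin L) × (K × Fin N)) ω => star (D ω t.1.1 t.1.2) * c t.2.1 ω t.2.2)
      (fun j ω => z ω j) with hξ
  have hξω : ∀ ω, (fun t => ξ t ω) = Sum.elim
      (fun (t : (Fin N × Fin L) × (K × Fin N)) => star (D ω t.1.1 t.1.2) * c t.2.1 ω t.2.2)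
      (z ω) := fun ω => by
    funext t
    rcases t with t | j <;> rfl
  have hhξ : ∀ l ω, h l ω = H l *ᵥ fun t => ξ t ω := by
    intro l ω
    rw [hh, hChan_eq _ _ _ _ _ _ _ _ hSRISm.1 hSAP.1, hξω, hH]
    simp only [fromCols_mulVec, Sum.elim_comp_inl, Sum.elim_comp_inr, zero_mulVec, add_zero]
    exact (cascadeCoeff_mulVec (r l) SAP (T l) l (D ω) (fun l => c l ω)).symm
  have hyξ : ∀ ω, y ω = Y *ᵥ fun t => ξ t ω := by
    intro ω
    have hz' : z ω = Z *ᵥ fun t => ξ t ω := by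
      rw [hξω, hZ]
      simp only [fromCols_mulVec, Sum.elim_comp_inl, Sum.elim_comp_inr, zero_mulVec, zero_add,
        one_mulVec]
    rw [hy, hY, add_mulVec, smul_mulVec, sum_mulVec, ← hz']
    simp only [hhξ]
  have hmse : ∀ B : Matrix (Fin L) (Fin L) ℂ,
      ((∫ ω, ∑ i, ‖(B *ᵥ y ω - h k ω) i‖ ^ 2 ∂μ : ℝ) : ℂ)
        = ((B * Y - H k) * (B * Y - H k)ᴴ).trace := by
    intro B
    rw [← hwhite.integral_sum_norm_sq]
    simp only [hyξ, hhξ, sub_mulVec, mulVec_mulVec]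
  have hhat' : ∀ ω, hhat ω = (s • (Rm k * Q)) *ᵥ y ω := fun ω => by
    rw [hhat_def, smul_mulVec]
  have hle := trace_error_le Y (H k) (s • (Rm k * Q)) C horth
  rw [← hmse, ← hmse] at hle
  simp only [hhat', ge_iff_le]
  exact_mod_cast hle
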